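/- Repeated delay simulation is strictly weaker than double delay simulation on a concrete instance: let E = {schedule, init, work, done} be a four-element event type. Let A1 have states {q0, q1, q2} with transitions q0 →schedule q1, q1 →init q2, q2 →work q2, q2 →done q0 and accepting set F1 = {q1}, and let A2 have states {r0, r1} with transitions r0 →done r1, r0 →e r0 for every e ≠ done, r1 →e r0 for every e, and accepting set F2 = {r1}. Then (q0, r0) ∉ fsim_2delay, but (q0, r0) ∈ fsim_rdelay. -/

import Mathlib

namespace AFS

/-- Greatest fixed point (Knaster–Tarski): for a monotone `f`, this is the
greatest fixed point of `f`. -/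
def gfp {α : Type*} [CompleteLattice α] (f : α → α) : α := sSup {a | a ≤ f a}

/-- Least fixed point (Knaster–Tarski): for a monotone `f`, this is the
least fixed point of `f`. -/
def lfp {α : Type*} [CompleteLattice α] (f : α → α) : α := sInf {a | f a ≤ a}

variable {E S S1 S2 : Type*}

/-- `ρ` is a run of the transition relation `step` from state `s` over the infinite word `τ`. -/
def IsRun (step : S → E → S → Prop) (s : S) (τ : ℕ → E) (ρ : ℕ → S) : Prop :=
  ρ 0 = s ∧ ∀ n, step (ρ n) (τ n) (ρ (n + 1))

/-- Büchi language of a state: words admitting a run visiting `F` infinitely often. -/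
def Lang (step : S → E → S → Prop) (F : Set S) (s : S) : Set (ℕ → E) :=
  {τ | ∃ ρ, IsRun step s τ ρ ∧ {n | ρ n ∈ F}.Infinite}

/-- Traces of a state: words admitting a run (no acceptance requirement). -/
def Traces (step : S → E → S → Prop) (s : S) : Set (ℕ → E) :=
  {τ | ∃ ρ, IsRun step s τ ρ}

/-- One-step matching operator on relations. -/
def Match (step1 : S1 → E → S1 → Prop) (step2 : S2 → E → S2 → Prop)
    (X : S1 → S2 → Prop) : S1 → S2 → Prop :=
  fun s1 s2 => ∀ e s1', step1 s1 e s1' → ∃ s2', step2 s2 e s2' ∧ X s1' s2'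

/-- Inductive part of delay simulation: reach a right-accepting state, then pass to `X`. -/
def fsimRdelay (step1 : S1 → E → S1 → Prop) (step2 : S2 → E → S2 → Prop)
    (F2 : Set S2) (X : S1 → S2 → Prop) : S1 → S2 → Prop :=
  lfp (fun Y =>
    (fun s1 s2 => s2 ∈ F2 ∧ Match step1 step2 X s1 s2) ⊔ Match step1 step2 Y)

/-- Functor underlying delay simulation. -/
def fsimLdelayF (step1 : S1 → E → S1 → Prop) (F1 : Set S1)
    (step2 : S2 → E → S2 → Prop) (F2 : Set S2)
    (X : S1 → S2 → Prop) : S1 → S2 → Prop :=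
  fsimRdelay step1 step2 F2 X ⊔ (fun s1 s2 => s1 ∉ F1 ∧ Match step1 step2 X s1 s2)

/-- Delay simulation. -/
def fsimLdelay (step1 : S1 → E → S1 → Prop) (F1 : Set S1)
    (step2 : S2 → E → S2 → Prop) (F2 : Set S2) : S1 → S2 → Prop :=
  gfp (fsimLdelayF step1 F1 step2 F2)

/-- The `delay` operator: wait for finitely many steps, then pass to `X`. -/
def delay (step1 : S1 → E → S1 → Prop) (step2 : S2 → E → S2 → Prop)
    (X : S1 → S2 → Prop) : S1 → S2 → Prop :=
  lfp (fun Y => Match step1 step2 Y ⊔ X)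

/-- Double delay simulation. -/
def fsim2delay (step1 : S1 → E → S1 → Prop) (F1 : Set S1)
    (step2 : S2 → E → S2 → Prop) (F2 : Set S2) : S1 → S2 → Prop :=
  delay step1 step2 (fsimLdelay step1 F1 step2 F2)

/-- `fsimW`: wait for finitely many steps, then pass to `X` (alias of `delay`). -/
def fsimW (step1 : S1 → E → S1 → Prop) (step2 : S2 → E → S2 → Prop)
    (X : S1 → S2 → Prop) : S1 → S2 → Prop :=
  lfp (fun Y => Match step1 step2 Y ⊔ X)

/-- Inductive part of repeated delay simulation: reach a right-accepting state,
then pass to `fsimW X`. -/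
def fsimRr (step1 : S1 → E → S1 → Prop) (step2 : S2 → E → S2 → Prop)
    (F2 : Set S2) (X : S1 → S2 → Prop) : S1 → S2 → Prop :=
  lfp (fun Y =>
    (fun s1 s2 => s2 ∈ F2 ∧ Match step1 step2 (fsimW step1 step2 X) s1 s2) ⊔
      Match step1 step2 Y)

/-- Coinductive part of repeated delay simulation. -/
def fsimLr (step1 : S1 → E → S1 → Prop) (F1 : Set S1)
    (step2 : S2 → E → S2 → Prop) (F2 : Set S2) : S1 → S2 → Prop :=
  gfp (fun X => fsimRr step1 step2 F2 X ⊔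
    (fun s1 s2 => s1 ∉ F1 ∧ Match step1 step2 X s1 s2))

/-- Repeated delay simulation. -/
def fsimRdelaySim (step1 : S1 → E → S1 → Prop) (F1 : Set S1)
    (step2 : S2 → E → S2 → Prop) (F2 : Set S2) : S1 → S2 → Prop :=
  fsimW step1 step2 (fsimLr step1 F1 step2 F2)

/-- Events for the scheduler example. -/
inductive Ev : Type
  | schedule | init | work | done

/-- States of the left automaton. -/
inductive St1 : Type
  | q0 | q1 | q2

/-- Transitions of the left automaton. -/
inductive Step1 : St1 → Ev → St1 → Prop
  | sched : Step1 .q0 .schedule .q1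
  | init : Step1 .q1 .init .q2
  | work : Step1 .q2 .work .q2
  | done : Step1 .q2 .done .q0

/-- States of the right automaton. -/
inductive St2 : Type
  | r0 | r1

/-- Transitions of the right automaton: `r0 →done r1`, `r0 →e r0` for `e ≠ done`,
`r1 →e r0` for every `e`. -/
inductive Step2 : St2 → Ev → St2 → Prop
  | done : Step2 .r0 .done .r1
  | loop0 (e : Ev) : e ≠ .done → Step2 .r0 e .r0
  | back (e : Ev) : Step2 .r1 e .r0

theorem lfp_le {α : Type*} [CompleteLattice α] {f : α → α} {a : α} (h : f a ≤ a) :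
    lfp f ≤ a :=
  sInf_le h

theorem map_lfp_le {α : Type*} [CompleteLattice α] {f : α → α} (hf : Monotone f) :
    f (lfp f) ≤ lfp f :=
  le_sInf fun _ hb => (hf (lfp_le hb)).trans hb

theorem le_gfp {α : Type*} [CompleteLattice α] {f : α → α} {a : α} (h : a ≤ f a) :
    a ≤ gfp f :=
  le_sSup h

theorem gfp_le_map {α : Type*} [CompleteLattice α] {f : α → α} (hf : Monotone f) :
    gfp f ≤ f (gfp f) :=
  sSup_le fun _ hb => hb.trans (hf (le_gfp hb))

section

variable {step1 : S1 → E → S1 → Prop} {step2 : S2 → E → S2 → Prop}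

theorem match_mono : Monotone (Match step1 step2) :=
  fun _ _ h _ _ hm e t1 h1 =>
    let ⟨t2, h2, hx⟩ := hm e t1 h1
    ⟨t2, h2, h _ _ hx⟩

theorem fsimRdelay_mono (F2 : Set S2) : Monotone (fsimRdelay step1 step2 F2) := by
  intro X X' h
  refine le_sInf fun Y hY => lfp_le (le_trans ?_ hY)
  exact sup_le_sup_right (fun _ _ hx => ⟨hx.1, match_mono h _ _ hx.2⟩) _

theorem fsimLdelayF_mono (F1 : Set S1) (F2 : Set S2) :
    Monotone (fsimLdelayF step1 F1 step2 F2) := by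
  intro X X' h
  exact sup_le_sup (fsimRdelay_mono F2 h) fun _ _ hx => ⟨hx.1, match_mono h _ _ hx.2⟩

theorem fsimW_unfold (X : S1 → S2 → Prop) :
    Match step1 step2 (fsimW step1 step2 X) ⊔ X ≤ fsimW step1 step2 X :=
  map_lfp_le fun _ _ h => sup_le_sup_right (match_mono h) X

theorem fsimW_of_match {X : S1 → S2 → Prop} {s1 : S1} {s2 : S2}
    (h : Match step1 step2 (fsimW step1 step2 X) s1 s2) : fsimW step1 step2 X s1 s2 :=
  fsimW_unfold X _ _ (Or.inl h)

theorem fsimW_of_rel {X : S1 → S2 → Prop} {s1 : S1} {s2 : S2}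
    (h : X s1 s2) : fsimW step1 step2 X s1 s2 :=
  fsimW_unfold X _ _ (Or.inr h)

theorem fsimRr_of_accepting {F2 : Set S2} {X : S1 → S2 → Prop} {s1 : S1} {s2 : S2}
    (hs : s2 ∈ F2) (h : Match step1 step2 (fsimW step1 step2 X) s1 s2) :
    fsimRr step1 step2 F2 X s1 s2 :=
  map_lfp_le (fun _ _ h => sup_le_sup_left (match_mono h) _) _ _ (Or.inl ⟨hs, h⟩)

end

/-- A pair of states reachable in the synchronous product from `(q0, r0)`. -/
def Reachable : St1 → St2 → Prop := fun s1 s2 => s2 = .r0 ∨ s1 = .q0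

theorem not_match_of_reachable {Y : St1 → St2 → Prop}
    (hY : ∀ s1 s2, Reachable s1 s2 → ¬ Y s1 s2) {s1 : St1} {s2 : St2}
    (h : Reachable s1 s2) : ¬ Match Step1 Step2 Y s1 s2 := by
  intro hm
  have key : ∀ {e t1}, Step1 s1 e t1 → e ≠ .done → False := by
    intro e t1 h1 he
    obtain ⟨t2, h2, hy⟩ := hm _ _ h1
    refine hY _ _ (Or.inl ?_) hy
    cases h2 <;> first | rfl | exact absurd rfl he
  cases s1
  · exact key .sched nofun
  · exact key .init nofun
  · exact key .work nofun

theorem not_fsimRdelay_of_ne_q0 (X : St1 → St2 → Prop) {s1 : St1} (hs : s1 ≠ .q0) :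
    ¬ fsimRdelay Step1 Step2 {St2.r1} X s1 .r0 := by
  intro h
  refine lfp_le (a := fun t1 t2 => ¬ (t1 ≠ .q0 ∧ t2 = .r0)) ?_ _ _ h ⟨hs, rfl⟩
  rintro t1 t2 (⟨h2, -⟩ | hm) ⟨hne, rfl⟩
  · cases h2
  · cases t1
    · exact hne rfl
    · obtain ⟨_, h2, hy⟩ := hm _ _ .init
      cases h2
      exact hy ⟨nofun, rfl⟩
    · obtain ⟨_, h2, hy⟩ := hm _ _ .work
      cases h2
      exact hy ⟨nofun, rfl⟩

theorem not_fsimRdelay_of_reachable {X : St1 → St2 → Prop} (hX : ¬ X .q1 .r0)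
    {s1 : St1} {s2 : St2} (hr : Reachable s1 s2) :
    ¬ fsimRdelay Step1 Step2 {St2.r1} X s1 s2 := by
  intro h
  refine lfp_le (a := fun t1 t2 => ¬ Reachable t1 t2) ?_ _ _ h hr
  rintro t1 t2 (⟨rfl, hm⟩ | hm) hr'
  · obtain h0 | rfl := hr'
    · cases h0
    · obtain ⟨_, h2, hx⟩ := hm _ _ .sched
      cases h2
      exact hX hx
  · exact not_match_of_reachable (fun _ _ hr hn => hn hr) hr' hm

theorem not_fsimLdelay_of_reachable {s1 : St1} {s2 : St2} (hr : Reachable s1 s2) :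
    ¬ fsimLdelay Step1 {St1.q1} Step2 {St2.r1} s1 s2 := by
  have unfold_le := gfp_le_map (fsimLdelayF_mono (step1 := Step1) (step2 := Step2)
    {St1.q1} {St2.r1})
  have h10 : ¬ fsimLdelay Step1 {St1.q1} Step2 {St2.r1} .q1 .r0 := by
    intro h
    obtain h | h := unfold_le _ _ h
    · exact not_fsimRdelay_of_ne_q0 (s1 := .q1) _ nofun h
    · exact h.1 rfl
  have h0 : ∀ s2, ¬ fsimLdelay Step1 {St1.q1} Step2 {St2.r1} .q0 s2 := by
    intro s2 h
    obtain h | ⟨-, h⟩ := unfold_le _ _ h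
    · exact not_fsimRdelay_of_reachable h10 (Or.inr rfl) h
    · obtain ⟨_, h2, hx⟩ := h _ _ .sched
      cases h2 <;> exact h10 hx
  obtain rfl | rfl := hr
  · cases s1
    · exact h0 _
    · exact h10
    · intro h
      obtain h | ⟨-, h⟩ := unfold_le _ _ h
      · exact not_fsimRdelay_of_ne_q0 (s1 := .q2) _ nofun h
      · obtain ⟨_, -, hx⟩ := h _ _ .done
        exact h0 _ hx
  · exact h0 _

theorem not_fsim2delay_of_reachable {s1 : St1} {s2 : St2} (hr : Reachable s1 s2) :
    ¬ fsim2delay Step1 {St1.q1} Step2 {St2.r1} s1 s2 := by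
  intro h
  refine lfp_le (a := fun t1 t2 => ¬ Reachable t1 t2) ?_ _ _ h hr
  rintro t1 t2 (hm | hx) hr'
  · exact not_match_of_reachable (fun _ _ hr hn => hn hr) hr' hm
  · exact not_fsimLdelay_of_reachable hr' hx

theorem fsimW_q1_of_q2 {X : St1 → St2 → Prop} (hX : X .q2 .r0) :
    fsimW Step1 Step2 X .q1 .r0 := by
  refine fsimW_of_match fun e t1 h1 => ?_
  cases h1
  exact ⟨.r0, .loop0 _ nofun, fsimW_of_rel hX⟩

theorem fsimLr_q2_r0 : fsimLr Step1 {St1.q1} Step2 {St2.r1} .q2 .r0 := by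
  refine le_gfp (a := fun s1 s2 => s1 = .q2 ∧ s2 = .r0 ∨ s1 = .q0 ∧ s2 = .r1) ?_ _ _
    (Or.inl ⟨rfl, rfl⟩)
  rintro _ _ (⟨rfl, rfl⟩ | ⟨rfl, rfl⟩)
  · refine Or.inr ⟨nofun, fun e t1 h1 => ?_⟩
    cases h1
    · exact ⟨.r0, .loop0 _ nofun, Or.inl ⟨rfl, rfl⟩⟩
    · exact ⟨.r1, .done, Or.inr ⟨rfl, rfl⟩⟩
  · refine Or.inl (fsimRr_of_accepting rfl fun e t1 h1 => ?_)
    cases h1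
    exact ⟨.r0, .back _, fsimW_q1_of_q2 (Or.inl ⟨rfl, rfl⟩)⟩

/-- `(q0, r0)` is not in the double delay simulation, but it is in the repeated
delay simulation. -/
theorem stmt17 :
    ¬ fsim2delay Step1 ({St1.q1} : Set St1) Step2 ({St2.r1} : Set St2) St1.q0 St2.r0 ∧
    fsimRdelaySim Step1 ({St1.q1} : Set St1) Step2 ({St2.r1} : Set St2) St1.q0 St2.r0 := by
  refine ⟨not_fsim2delay_of_reachable (Or.inl rfl), fsimW_of_match fun e t1 h1 => ?_⟩
  cases h1
  exact ⟨.r0, .loop0 _ nofun, fsimW_q1_of_q2 fsimLr_q2_r0⟩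

end AFS
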